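/- Let G be a hereditary modular graph. Then metric balls are isometrically embedded in G: for every vertex v, every r ∈ ℕ, and any two vertices x, y ∈ B_r(v), there is a path from x to y of length d_G(x,y) all of whose vertices lie in B_r(v). (Graph formulation of Hoda's theorem that metric balls in a quadric complex are isometrically embedded in its 1-skeleton.) -/

import Mathlib

/-- A connected graph is modular if every triple of vertices has a median. -/
def Modular {W : Type*} (G : SimpleGraph W) : Prop :=
  G.Connected ∧ ∀ u v w : W, ∃ m : W,
    G.dist u m + G.dist m v = G.dist u v ∧
    G.dist u m + G.dist m w = G.dist u w ∧
    G.dist v m + G.dist m w = G.dist v w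

/-- A connected graph is hereditary modular if every connected isometric subgraph
of it is modular. -/
def HereditaryModular {V : Type*} (G : SimpleGraph V) : Prop :=
  G.Connected ∧ ∀ H : G.Subgraph, H.Connected →
    (∀ x y : H.verts, H.coe.dist x y = G.dist x.1 y.1) → Modular H.coe

theorem SimpleGraph.Iso.dist_map_eq {V W : Type*} {G : SimpleGraph V} {G' : SimpleGraph W}
    (f : G ≃g G') (hG : G.Connected) (hG' : G'.Connected) (x y : V) :
    G'.dist (f x) (f y) = G.dist x y := by
  apply le_antisymm
  · obtain ⟨p, hp⟩ := hG.exists_walk_length_eq_dist x y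
    simpa [hp] using SimpleGraph.dist_le (p.map f.toHom)
  · obtain ⟨p, hp⟩ := hG'.exists_walk_length_eq_dist (f x) (f y)
    have h := SimpleGraph.dist_le (p.map f.symm.toHom)
    rw [SimpleGraph.Walk.length_map, hp] at h
    simpa using h

theorem HereditaryModular.modular {V : Type*} {G : SimpleGraph V} (hG : HereditaryModular G) :
    Modular G := by
  refine ⟨hG.1, fun u v w => ?_⟩
  have hc : (⊤ : G.Subgraph).coe.Connected :=
    SimpleGraph.Subgraph.topIso.connected_iff.mpr hG.1
  have hd : ∀ x y : (⊤ : G.Subgraph).verts, (⊤ : G.Subgraph).coe.dist x y = G.dist x.1 y.1 :=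
    fun x y => (SimpleGraph.Subgraph.topIso.dist_map_eq hc hG.1 x y).symm
  obtain ⟨m, hm⟩ := (hG.2 ⊤ ⟨hc⟩ hd).2 ⟨u, trivial⟩ ⟨v, trivial⟩ ⟨w, trivial⟩
  simp only [hd] at hm
  exact ⟨m.1, hm⟩

theorem SimpleGraph.Walk.dist_le_of_mem_support {V : Type*} {G : SimpleGraph V}
    {x m w : V} (p : G.Walk x m) (hw : w ∈ p.support) : G.dist w m ≤ p.length := by
  classical
  exact (SimpleGraph.dist_le (p.dropUntil w hw)).trans (p.length_dropUntil_le_length hw)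

/-- A geodesic from `x` to a vertex between `v` and `x` stays within distance `d(v, x)` of `v`. -/
theorem SimpleGraph.Walk.dist_le_dist_of_mem_support_of_between {V : Type*} {G : SimpleGraph V}
    (hG : G.Connected) {v x m w : V} (hm : G.dist v m + G.dist m x = G.dist v x)
    (p : G.Walk m x) (hp : p.length = G.dist m x) (hw : w ∈ p.support) :
    G.dist v w ≤ G.dist v x := by
  have h := p.reverse.dist_le_of_mem_support (w := w) (by simpa using hw)
  rw [SimpleGraph.Walk.length_reverse, SimpleGraph.dist_comm] at h
  have := hG.dist_triangle (u := v) (v := m) (w := w)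
  omega

/-- Metric balls in a hereditary modular graph are isometrically embedded. -/
theorem balls_isometrically_embedded {V : Type*} (G : SimpleGraph V)
    (hG : HereditaryModular G) (v : V) (r : ℕ) (x y : V)
    (hx : G.dist v x ≤ r) (hy : G.dist v y ≤ r) :
    ∃ p : G.Walk x y, p.length = G.dist x y ∧ ∀ w ∈ p.support, G.dist v w ≤ r := by
  obtain ⟨m, hmx, hmy, hxy⟩ := hG.modular.2 v x y
  obtain ⟨p, hp⟩ := hG.1.exists_walk_length_eq_dist m x
  obtain ⟨q, hq⟩ := hG.1.exists_walk_length_eq_dist m y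
  refine ⟨p.reverse.append q, ?_, fun w hw => ?_⟩
  · rw [SimpleGraph.Walk.length_append, SimpleGraph.Walk.length_reverse, hp, hq,
      G.dist_comm (u := m) (v := x), hxy]
  · rw [SimpleGraph.Walk.mem_support_append_iff, SimpleGraph.Walk.support_reverse,
      List.mem_reverse] at hw
    rcases hw with hw | hw
    · exact (p.dist_le_dist_of_mem_support_of_between hG.1 hmx hp hw).trans hx
    · exact (q.dist_le_dist_of_mem_support_of_between hG.1 hmy hq hw).trans hy
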